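/- Let (a_l)_{l∈ℤ^d} be real with a_l = a_{−l}, Σ|a_l| < ∞, K(x) = Σ_{l∈ℤ^d} a_l e^{i l·x}, and suppose ρ_j(0) ≠ 0 for all j ∈ Ω_n* = Ω_n∖{0}. Then for every function f : 𝕋^d → ℝ there exists a unique interpolating sk-spline of f with knots and interpolation points x_k, k ∈ Ω_n, and it is given by sk_n(f,x) = Σ_{k∈Ω_n} f(x_k)·s̃k_n(x−x_k). -/

import Mathlib

open Real Finset MeasureTheory

noncomputable section

/-- The index set `Ω_n = {j ∈ ℤ^d : 0 ≤ j_l ≤ 2 n_l - 1}`. -/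
def Omega (d : ℕ) (n : Fin d → ℕ) : Finset (Fin d → ℤ) :=
  Fintype.piFinset fun i => Finset.Icc (0 : ℤ) (2 * (n i : ℤ) - 1)

/-- The knot `x_k = (π k₁ / n₁, …, π k_d / n_d)`. -/
def knot (d : ℕ) (n : Fin d → ℕ) (k : Fin d → ℤ) : Fin d → ℝ :=
  fun i => π * (k i : ℝ) / (n i : ℝ)

/-- The dot product `l · x` for `l ∈ ℤ^d`, `x ∈ ℝ^d`. -/
def dotI (d : ℕ) (l : Fin d → ℤ) (x : Fin d → ℝ) : ℝ := ∑ i, (l i : ℝ) * x i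

/-- `N = 2^d n₁ ⋯ n_d`. -/
def Nn (d : ℕ) (n : Fin d → ℕ) : ℝ := ∏ i : Fin d, (2 * (n i : ℝ))

/-- `Ω_n^* = Ω_n \ {0}`. -/
def OmegaStar (d : ℕ) (n : Fin d → ℕ) : Finset (Fin d → ℤ) :=
  (Omega d n).erase 0

/-- `λ_j(x) = Σ_{k ∈ Ω_n} e^{i j·x_k} K(x - x_k)`. -/
def lam (d : ℕ) (n : Fin d → ℕ) (K : (Fin d → ℝ) → ℝ) (j : Fin d → ℤ)
    (x : Fin d → ℝ) : ℂ :=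
  ∑ k ∈ Omega d n, Complex.exp (Complex.I * (dotI d j (knot d n k) : ℂ)) *
    (K (x - knot d n k) : ℂ)

/-- `ρ_j(x) = (2/N)·Re λ_j(x)`. -/
def rho (d : ℕ) (n : Fin d → ℕ) (K : (Fin d → ℝ) → ℝ) (j : Fin d → ℤ)
    (x : Fin d → ℝ) : ℝ := (2 / Nn d n) * (lam d n K j x).re

/-- `σ_j(x) = (2/N)·Im λ_j(x)`. -/
def sigma' (d : ℕ) (n : Fin d → ℕ) (K : (Fin d → ℝ) → ℝ) (j : Fin d → ℤ)
    (x : Fin d → ℝ) : ℝ := (2 / Nn d n) * (lam d n K j x).im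

/-- The fundamental sk-spline `s̃k_n(x) = 1/N + (1/N) Σ_{j∈Ω_n*} ρ_j(x)/ρ_j(0)`. -/
def fundSk (d : ℕ) (n : Fin d → ℕ) (K : (Fin d → ℝ) → ℝ) (x : Fin d → ℝ) : ℝ :=
  1 / Nn d n + (1 / Nn d n) * ∑ j ∈ OmegaStar d n, rho d n K j x / rho d n K j 0

/-- The interpolating sk-spline `sk_n(f,x) = Σ_{k∈Ω_n} f(x_k) s̃k_n(x - x_k)`. -/
def skInterp (d : ℕ) (n : Fin d → ℕ) (K : (Fin d → ℝ) → ℝ)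
    (f : (Fin d → ℝ) → ℝ) (x : Fin d → ℝ) : ℝ :=
  ∑ k ∈ Omega d n, f (knot d n k) * fundSk d n K (x - knot d n k)

/-- The (complex-valued) kernel `K(x) = Σ_{l ∈ ℤ^d} a_l e^{i l·x}`. -/
def Kc (d : ℕ) (a : (Fin d → ℤ) → ℝ) (x : Fin d → ℝ) : ℂ :=
  ∑' l : Fin d → ℤ, (a l : ℂ) * Complex.exp (Complex.I * (dotI d l x : ℂ))

/-- The real part of the kernel; for `a_l = a_{-l}` this is the kernel itself. -/
def Kr (d : ℕ) (a : (Fin d → ℤ) → ℝ) (x : Fin d → ℝ) : ℝ := (Kc d a x).re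

/-- `S` is an sk-spline on `Λ_n` associated with the kernel `K`. -/
def IsSkSpline (d : ℕ) (n : Fin d → ℕ) (K : (Fin d → ℝ) → ℝ)
    (S : (Fin d → ℝ) → ℝ) : Prop :=
  ∃ (c : ℝ) (cf : (Fin d → ℤ) → ℝ),
    (∑ k ∈ Omega d n, cf k = 0) ∧
    ∀ x, S x = c + ∑ k ∈ Omega d n, cf k * K (x - knot d n k)

/-- `F` depends on its argument only modulo `2 n_i` in every coordinate `i`. -/
def GridPeriodic {M : Type*} (d : ℕ) (n : Fin d → ℕ) (F : (Fin d → ℤ) → M) : Prop :=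
  ∀ k k' : Fin d → ℤ, (∀ i, k i ≡ k' i [ZMOD 2 * (n i : ℤ)]) → F k = F k'

/-- The character `e^{i j·x_k}`. -/
def gridChar (d : ℕ) (n : Fin d → ℕ) (j k : Fin d → ℤ) : ℂ :=
  Complex.exp (Complex.I * (dotI d j (knot d n k) : ℂ))

lemma mem_Omega {d : ℕ} {n : Fin d → ℕ} {k : Fin d → ℤ} :
    k ∈ Omega d n ↔ ∀ i, 0 ≤ k i ∧ k i < 2 * (n i : ℤ) := by
  simp only [Omega, Fintype.mem_piFinset, Finset.mem_Icc]
  exact forall_congr' fun i => by omega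

lemma card_Omega (d : ℕ) (n : Fin d → ℕ) : ((Omega d n).card : ℝ) = Nn d n := by
  simp only [Omega, Fintype.card_piFinset, Int.card_Icc, Nn]
  push_cast
  refine Finset.prod_congr rfl fun i _ => ?_
  have h : (2 * (n i : ℤ) - 1 + 1 - 0).toNat = 2 * n i := by omega
  rw [h]
  push_cast
  rfl

lemma Nn_pos {d : ℕ} {n : Fin d → ℕ} (hn : ∀ i, 1 ≤ n i) : 0 < Nn d n := by
  refine Finset.prod_pos fun i _ => ?_
  have : (0 : ℝ) < n i := by exact_mod_cast hn i
  positivity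

lemma zero_mem_Omega {d : ℕ} {n : Fin d → ℕ} (hn : ∀ i, 1 ≤ n i) :
    (0 : Fin d → ℤ) ∈ Omega d n :=
  mem_Omega.2 fun i => by
    have := hn i
    simp only [Pi.zero_apply]
    omega

lemma Omega_eq_of_modEq {d : ℕ} {n : Fin d → ℕ} {k k' : Fin d → ℤ} (hk : k ∈ Omega d n)
    (hk' : k' ∈ Omega d n) (h : ∀ i, k i ≡ k' i [ZMOD 2 * (n i : ℤ)]) : k = k' := by
  funext i
  have h1 := mem_Omega.1 hk i
  have h2 := mem_Omega.1 hk' i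
  have h3 := h i
  rwa [Int.ModEq, Int.emod_eq_of_lt h1.1 h1.2, Int.emod_eq_of_lt h2.1 h2.2] at h3

section Sums

variable {M : Type*} [AddCommMonoid M] {d : ℕ} {n : Fin d → ℕ} {F : (Fin d → ℤ) → M}

lemma emod_mem_Omega (hn : ∀ i, 1 ≤ n i) (k : Fin d → ℤ) :
    (fun i => k i % (2 * (n i : ℤ))) ∈ Omega d n :=
  mem_Omega.2 fun i => by
    have := hn i
    exact ⟨Int.emod_nonneg _ (by omega), Int.emod_lt_of_pos _ (by omega)⟩

lemma sum_Omega_add (hn : ∀ i, 1 ≤ n i) (hF : GridPeriodic d n F) (m : Fin d → ℤ) :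
    ∑ k ∈ Omega d n, F (k + m) = ∑ k ∈ Omega d n, F k := by
  refine Finset.sum_nbij' (fun k i => (k i + m i) % (2 * (n i : ℤ)))
    (fun k i => (k i - m i) % (2 * (n i : ℤ))) (fun k _ => emod_mem_Omega hn (k + m))
    (fun k _ => emod_mem_Omega hn (k - m)) ?_ ?_ ?_
  · intro k hk
    refine Omega_eq_of_modEq (emod_mem_Omega hn _) hk fun i => ?_
    refine (Int.mod_modEq _ _).trans (((Int.mod_modEq _ _).sub_right _).trans ?_)
    simp [Int.ModEq.refl]
  · intro k hk
    refine Omega_eq_of_modEq (emod_mem_Omega hn _) hk fun i => ?_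
    refine (Int.mod_modEq _ _).trans (((Int.mod_modEq _ _).add_right _).trans ?_)
    simp [Int.ModEq.refl]
  · exact fun k _ => hF _ _ fun i => (Int.mod_modEq _ _).symm

lemma sum_Omega_neg (hn : ∀ i, 1 ≤ n i) (hF : GridPeriodic d n F) :
    ∑ k ∈ Omega d n, F (-k) = ∑ k ∈ Omega d n, F k := by
  have key : ∀ k ∈ Omega d n, (fun i => (-(fun i => (-k i) % (2 * (n i : ℤ))) i)
      % (2 * (n i : ℤ))) = k := fun k hk => by
    refine Omega_eq_of_modEq (emod_mem_Omega hn _) hk fun i => ?_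
    refine (Int.mod_modEq _ _).trans ((Int.mod_modEq _ _).neg.trans ?_)
    simp [Int.ModEq.refl]
  exact Finset.sum_nbij' (fun k i => (-k i) % (2 * (n i : ℤ)))
    (fun k i => (-k i) % (2 * (n i : ℤ))) (fun k _ => emod_mem_Omega hn (-k))
    (fun k _ => emod_mem_Omega hn (-k)) key key
    (fun k _ => hF _ _ fun i => (Int.mod_modEq _ _).symm)

end Sums

lemma knot_add (d : ℕ) (n : Fin d → ℕ) (k m : Fin d → ℤ) :
    knot d n (k + m) = knot d n k + knot d n m := by
  funext i
  simp only [knot, Pi.add_apply, Int.cast_add]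
  ring

lemma knot_neg (d : ℕ) (n : Fin d → ℕ) (k : Fin d → ℤ) : knot d n (-k) = -knot d n k := by
  funext i
  simp only [knot, Pi.neg_apply, Int.cast_neg]
  ring

lemma knot_sub (d : ℕ) (n : Fin d → ℕ) (k m : Fin d → ℤ) :
    knot d n (k - m) = knot d n k - knot d n m := by
  rw [sub_eq_add_neg, knot_add, knot_neg, ← sub_eq_add_neg]

lemma dotI_add (d : ℕ) (l : Fin d → ℤ) (x y : Fin d → ℝ) :
    dotI d l (x + y) = dotI d l x + dotI d l y := by
  simp [dotI, mul_add, Finset.sum_add_distrib]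

lemma exp_dotI_add_knot {d : ℕ} {n : Fin d → ℕ} (hn : ∀ i, 1 ≤ n i) (l k : Fin d → ℤ)
    (x : Fin d → ℝ) (hk : ∀ i, k i ≡ 0 [ZMOD 2 * (n i : ℤ)]) :
    Complex.exp (Complex.I * (dotI d l (x + knot d n k) : ℂ)) =
      Complex.exp (Complex.I * (dotI d l x : ℂ)) := by
  choose t ht using fun i => Int.modEq_zero_iff_dvd.1 (hk i)
  have h : dotI d l (knot d n k) = ((∑ i, l i * t i : ℤ) : ℝ) * (2 * π) := by
    simp only [dotI, knot]
    push_cast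
    rw [Finset.sum_mul]
    refine Finset.sum_congr rfl fun i _ => ?_
    have : (n i : ℝ) ≠ 0 := by
      have := hn i
      positivity
    rw [ht i]
    push_cast
    field_simp
  rw [dotI_add, h]
  push_cast
  rw [mul_add, Complex.exp_add]
  have h2 := Complex.exp_int_mul_two_pi_mul_I (∑ i, l i * t i)
  push_cast at h2
  rw [show Complex.I * ((∑ i, (l i : ℂ) * (t i : ℂ)) * (2 * (π : ℂ))) =
    (∑ i, (l i : ℂ) * (t i : ℂ)) * (2 * π * Complex.I) by ring, h2, mul_one]

section Character

variable {d : ℕ} {n : Fin d → ℕ}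

lemma gridChar_comm (j k : Fin d → ℤ) : gridChar d n j k = gridChar d n k j := by
  have : dotI d j (knot d n k) = dotI d k (knot d n j) :=
    Finset.sum_congr rfl fun i _ => by simp only [knot]; ring
  rw [gridChar, gridChar, this]

lemma gridChar_add (j k m : Fin d → ℤ) :
    gridChar d n j (k + m) = gridChar d n j k * gridChar d n j m := by
  rw [gridChar, knot_add, dotI_add]
  push_cast
  rw [mul_add, Complex.exp_add]
  rfl

lemma gridChar_zero (j : Fin d → ℤ) : gridChar d n j 0 = 1 := by
  simp [gridChar, knot, dotI]

lemma zero_gridChar (k : Fin d → ℤ) : gridChar d n 0 k = 1 := by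
  rw [gridChar_comm, gridChar_zero]

lemma conj_gridChar (j k : Fin d → ℤ) :
    (starRingEnd ℂ) (gridChar d n j k) = gridChar d n j (-k) := by
  have : dotI d j (knot d n (-k)) = -dotI d j (knot d n k) := by
    rw [knot_neg]
    simp [dotI]
  rw [gridChar, gridChar, this, ← Complex.exp_conj]
  simp

lemma gridChar_periodic (hn : ∀ i, 1 ≤ n i) (j : Fin d → ℤ) :
    GridPeriodic d n (gridChar d n j) := by
  intro k k' h
  have h2 := exp_dotI_add_knot hn j (k - k') (knot d n k') fun i => by
    simpa using (h i).sub_right (k' i)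
  rwa [← knot_add, add_sub_cancel] at h2

lemma gridChar_single_eq_one (hn : ∀ i, 1 ≤ n i) {k : Fin d → ℤ} {i : Fin d}
    (h : gridChar d n (Pi.single i 1) k = 1) : k i ≡ 0 [ZMOD 2 * (n i : ℤ)] := by
  have h1 : dotI d (Pi.single i 1) (knot d n k) = π * (k i : ℝ) / (n i : ℝ) := by
    rw [dotI, Finset.sum_eq_single i]
    · simp [knot]
    · intro b _ hb
      simp [Pi.single_eq_of_ne hb]
    · simp
  rw [gridChar, h1, Complex.exp_eq_one_iff] at h
  obtain ⟨t, ht⟩ := h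
  have h2 : π * (k i : ℝ) / (n i : ℝ) = t * (2 * π) := by
    have h3 : ((π * (k i : ℝ) / (n i : ℝ) : ℝ) : ℂ) = ((t * (2 * π) : ℝ) : ℂ) := by
      apply mul_left_cancel₀ Complex.I_ne_zero
      rw [ht]
      push_cast
      ring
    exact_mod_cast h3
  have hni : (n i : ℝ) ≠ 0 := by
    have := hn i
    positivity
  have h4 : (k i : ℝ) = 2 * n i * t := by
    rw [div_eq_iff hni] at h2
    apply mul_left_cancel₀ Real.pi_ne_zero
    rw [h2]
    ring
  exact Int.modEq_zero_iff_dvd.2 ⟨t, by exact_mod_cast h4⟩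

lemma sum_gridChar_eq_zero (hn : ∀ i, 1 ≤ n i) {k : Fin d → ℤ}
    (hk : ¬ ∀ i, k i ≡ 0 [ZMOD 2 * (n i : ℤ)]) : ∑ j ∈ Omega d n, gridChar d n k j = 0 := by
  push Not at hk
  obtain ⟨i, hi⟩ := hk
  have h := sum_Omega_add hn (gridChar_periodic hn k) (Pi.single i 1)
  simp only [gridChar_add, ← Finset.sum_mul] at h
  by_contra h0
  have h1 := mul_left_cancel₀ h0 (h.trans (mul_one _).symm)
  rw [gridChar_comm] at h1
  exact hi (gridChar_single_eq_one hn h1)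

lemma sum_gridChar_eq_Nn (hn : ∀ i, 1 ≤ n i) {k : Fin d → ℤ}
    (hk : ∀ i, k i ≡ 0 [ZMOD 2 * (n i : ℤ)]) :
    ∑ j ∈ Omega d n, gridChar d n k j = (Nn d n : ℂ) := by
  rw [← card_Omega]
  simp [gridChar_comm k, gridChar_periodic hn _ k 0 hk, gridChar_zero]

lemma sum_gridChar_OmegaStar (hn : ∀ i, 1 ≤ n i) {j : Fin d → ℤ} (hj : j ∈ OmegaStar d n) :
    ∑ k ∈ Omega d n, gridChar d n j k = 0 :=
  sum_gridChar_eq_zero hn fun h => (Finset.mem_erase.1 hj).1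
    (Omega_eq_of_modEq (Finset.mem_erase.1 hj).2 (zero_mem_Omega hn) h)

lemma sum_gridChar_sub (hn : ∀ i, 1 ≤ n i) {p k : Fin d → ℤ} (hp : p ∈ Omega d n)
    (hk : k ∈ Omega d n) :
    ∑ j ∈ Omega d n, gridChar d n j (p - k) = if k = p then (Nn d n : ℂ) else 0 := by
  simp only [fun j => gridChar_comm (n := n) j (p - k)]
  split_ifs with h
  · exact sum_gridChar_eq_Nn hn fun i => by simp [h, Int.ModEq.refl]
  · refine sum_gridChar_eq_zero hn fun h2 => h (Omega_eq_of_modEq hk hp fun i => ?_)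
    simpa using ((h2 i).add_right (k i)).symm

end Character

section Kernel

variable {d : ℕ} {n : Fin d → ℕ} {K : (Fin d → ℝ) → ℝ}

lemma lam_eq_sum_gridChar (K : (Fin d → ℝ) → ℝ) (j : Fin d → ℤ) (x : Fin d → ℝ) :
    lam d n K j x = ∑ k ∈ Omega d n, gridChar d n j k * (K (x - knot d n k) : ℂ) :=
  rfl

lemma lam_knot (hn : ∀ i, 1 ≤ n i) (hK : ∀ x, GridPeriodic d n fun k => K (x - knot d n k))
    (j m : Fin d → ℤ) : lam d n K j (knot d n m) = gridChar d n j m * lam d n K j 0 := by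
  have hF : GridPeriodic d n fun k => gridChar d n j k * (K (knot d n m - knot d n k) : ℂ) :=
    fun k k' h => congrArg₂ (fun (z : ℂ) (y : ℝ) => z * (y : ℂ))
      (gridChar_periodic hn j k k' h) (hK _ k k' h)
  have h := sum_Omega_add hn hF m
  simp only [lam_eq_sum_gridChar] at h ⊢
  rw [← h, Finset.mul_sum]
  refine Finset.sum_congr rfl fun k _ => ?_
  rw [gridChar_add, knot_add, show knot d n m - (knot d n k + knot d n m) = 0 - knot d n k by
    abel]
  ring

lemma sum_gridChar_neg_mul (hn : ∀ i, 1 ≤ n i)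
    (hK : ∀ x, GridPeriodic d n fun k => K (x - knot d n k)) (j : Fin d → ℤ) :
    ∑ k ∈ Omega d n, gridChar d n j (-k) * (K (knot d n k) : ℂ) = lam d n K j 0 := by
  have hF : GridPeriodic d n fun k => gridChar d n j k * (K (0 - knot d n k) : ℂ) :=
    fun k k' h => congrArg₂ (fun (z : ℂ) (y : ℝ) => z * (y : ℂ))
      (gridChar_periodic hn j k k' h) (hK _ k k' h)
  rw [lam_eq_sum_gridChar, ← sum_Omega_neg hn hF]
  simp only [knot_neg, sub_neg_eq_add, zero_add]

lemma lam_zero_im (hn : ∀ i, 1 ≤ n i) (hK : ∀ x, GridPeriodic d n fun k => K (x - knot d n k))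
    (heven : ∀ x, K (-x) = K x) (j : Fin d → ℤ) : (lam d n K j 0).im = 0 := by
  rw [← Complex.conj_eq_iff_im]
  conv_rhs => rw [← sum_gridChar_neg_mul hn hK j]
  simp only [lam_eq_sum_gridChar, map_sum, map_mul, conj_gridChar, Complex.conj_ofReal,
    zero_sub, heven]

lemma rho_knot (hn : ∀ i, 1 ≤ n i) (hK : ∀ x, GridPeriodic d n fun k => K (x - knot d n k))
    (heven : ∀ x, K (-x) = K x) (j m : Fin d → ℤ) :
    rho d n K j (knot d n m) = (gridChar d n j m).re * rho d n K j 0 := by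
  rw [rho, rho, lam_knot hn hK, Complex.mul_re, lam_zero_im hn hK heven]
  ring

lemma fundSk_knot_sub (hn : ∀ i, 1 ≤ n i)
    (hK : ∀ x, GridPeriodic d n fun k => K (x - knot d n k)) (heven : ∀ x, K (-x) = K x)
    (hrho : ∀ j ∈ OmegaStar d n, rho d n K j 0 ≠ 0) {p k : Fin d → ℤ} (hp : p ∈ Omega d n)
    (hk : k ∈ Omega d n) :
    fundSk d n K (knot d n p - knot d n k) = if k = p then 1 else 0 := by
  have h1 : ∑ j ∈ OmegaStar d n, rho d n K j (knot d n (p - k)) / rho d n K j 0 =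
      ∑ j ∈ OmegaStar d n, (gridChar d n j (p - k)).re :=
    Finset.sum_congr rfl fun j hj => by
      rw [rho_knot hn hK heven, mul_div_cancel_right₀ _ (hrho j hj)]
  have h2 := congrArg Complex.re (sum_gridChar_sub hn hp hk)
  rw [Complex.re_sum, ← Finset.add_sum_erase _ _ (zero_mem_Omega hn), zero_gridChar,
    Complex.one_re, ← OmegaStar] at h2
  have hN := (Nn_pos hn).ne'
  rw [fundSk, ← knot_sub, h1, ← mul_one_add (1 / Nn d n), h2]
  split_ifs
  · rw [Complex.ofReal_re]
    field_simp
  · simp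

lemma skInterp_knot (hn : ∀ i, 1 ≤ n i)
    (hK : ∀ x, GridPeriodic d n fun k => K (x - knot d n k)) (heven : ∀ x, K (-x) = K x)
    (hrho : ∀ j ∈ OmegaStar d n, rho d n K j 0 ≠ 0) (f : (Fin d → ℝ) → ℝ) {p : Fin d → ℤ}
    (hp : p ∈ Omega d n) : skInterp d n K f (knot d n p) = f (knot d n p) := by
  rw [skInterp, Finset.sum_congr rfl fun k hk => by
    rw [fundSk_knot_sub hn hK heven hrho hp hk]]
  simp [hp]

lemma exists_fundSk_eq (hn : ∀ i, 1 ≤ n i) (K : (Fin d → ℝ) → ℝ) :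
    ∃ b : (Fin d → ℤ) → ℝ, GridPeriodic d n b ∧ ∑ k ∈ Omega d n, b k = 0 ∧
      ∀ x, fundSk d n K x = 1 / Nn d n + ∑ k ∈ Omega d n, b k * K (x - knot d n k) := by
  refine ⟨fun k => (1 / Nn d n) * ∑ j ∈ OmegaStar d n,
    (2 / Nn d n) * (gridChar d n j k).re / rho d n K j 0, ?_, ?_, ?_⟩
  · intro k k' h
    simp only [fun j => gridChar_periodic hn j k k' h]
  · rw [← Finset.mul_sum, Finset.sum_comm]
    simp only [← Finset.sum_div, ← Finset.mul_sum, ← Complex.re_sum]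
    rw [Finset.sum_congr rfl fun j hj => by rw [sum_gridChar_OmegaStar hn hj]]
    simp
  · intro x
    simp only [Finset.mul_sum, Finset.sum_mul]
    rw [fundSk, Finset.sum_comm, Finset.mul_sum]
    congr 1
    refine Finset.sum_congr rfl fun j _ => ?_
    rw [rho, lam_eq_sum_gridChar, Complex.re_sum, Finset.mul_sum, Finset.sum_div, Finset.mul_sum]
    refine Finset.sum_congr rfl fun k _ => ?_
    rw [Complex.re_mul_ofReal]
    ring

lemma isSkSpline_skInterp (hn : ∀ i, 1 ≤ n i)
    (hK : ∀ x, GridPeriodic d n fun k => K (x - knot d n k)) (f : (Fin d → ℝ) → ℝ) :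
    IsSkSpline d n K (skInterp d n K f) := by
  obtain ⟨b, hb, hb0, hfund⟩ := exists_fundSk_eq hn K
  have hshift : ∀ m, GridPeriodic d n fun k => b (k - m) := fun m k k' h =>
    hb _ _ fun i => (h i).sub_right _
  refine ⟨∑ m ∈ Omega d n, f (knot d n m) * (1 / Nn d n),
    fun k => ∑ m ∈ Omega d n, f (knot d n m) * b (k - m), ?_, fun x => ?_⟩
  · rw [Finset.sum_comm]
    refine Finset.sum_eq_zero fun m _ => ?_
    have h := sum_Omega_add hn (hshift m) m
    simp only [add_sub_cancel_right] at h
    rw [← Finset.mul_sum, ← h, hb0, mul_zero]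
  · simp only [Finset.sum_mul]
    rw [Finset.sum_comm, ← Finset.sum_add_distrib, skInterp]
    refine Finset.sum_congr rfl fun m _ => ?_
    have hF : GridPeriodic d n fun k => b (k - m) * K (x - knot d n k) :=
      fun k k' h => congrArg₂ (· * ·) (hshift m k k' h) (hK x k k' h)
    have h := sum_Omega_add hn hF m
    simp only [add_sub_cancel_right] at h
    simp only [mul_assoc]
    rw [← Finset.mul_sum, ← h, hfund, mul_add]
    congr 2
    refine Finset.sum_congr rfl fun k _ => ?_
    rw [knot_add, sub_sub, add_comm (knot d n m)]

lemma skSpline_coeff_eq_zero (hn : ∀ i, 1 ≤ n i)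
    (hK : ∀ x, GridPeriodic d n fun k => K (x - knot d n k)) (heven : ∀ x, K (-x) = K x)
    (hrho : ∀ j ∈ OmegaStar d n, rho d n K j 0 ≠ 0) {c : ℝ} {cf : (Fin d → ℤ) → ℝ}
    (hcf : ∑ k ∈ Omega d n, cf k = 0)
    (h : ∀ m ∈ Omega d n, c + ∑ k ∈ Omega d n, cf k * K (knot d n m - knot d n k) = 0) :
    c = 0 ∧ ∀ k ∈ Omega d n, cf k = 0 := by
  have hper : ∀ k, GridPeriodic d n fun m => K (knot d n m - knot d n k) := fun k m m' hm => by
    simpa only [sub_neg_eq_add, ← neg_sub (knot d n k), heven] using hK (knot d n k) m m' hm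
  have hneg : ∀ j, GridPeriodic d n fun m => gridChar d n j (-m) := fun j m m' hm =>
    gridChar_periodic hn j _ _ fun i => (hm i).neg
  have hlam : ∀ j k, ∑ m ∈ Omega d n, gridChar d n j (-m) * (K (knot d n m - knot d n k) : ℂ) =
      gridChar d n j (-k) * lam d n K j 0 := fun j k => by
    have hF : GridPeriodic d n fun m =>
        gridChar d n j (-m) * (K (knot d n m - knot d n k) : ℂ) :=
      fun m m' hm => congrArg₂ (fun (z : ℂ) (y : ℝ) => z * (y : ℂ)) (hneg j m m' hm)
        (hper k m m' hm)
    rw [← sum_Omega_add hn hF k, ← sum_gridChar_neg_mul hn hK, Finset.mul_sum]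
    refine Finset.sum_congr rfl fun m _ => ?_
    rw [neg_add, gridChar_add, knot_add, add_sub_cancel_right]
    ring
  have hdft : ∀ j ∈ Omega d n, ∑ k ∈ Omega d n, (cf k : ℂ) * gridChar d n j (-k) = 0 := by
    intro j hj
    by_cases hj0 : j = 0
    · simp only [hj0, zero_gridChar, mul_one]
      exact_mod_cast hcf
    have hj' : j ∈ OmegaStar d n := Finset.mem_erase.2 ⟨hj0, hj⟩
    have h1 : ∑ m ∈ Omega d n, gridChar d n j (-m) *
        ((c + ∑ k ∈ Omega d n, cf k * K (knot d n m - knot d n k) : ℝ) : ℂ) = 0 :=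
      Finset.sum_eq_zero fun m hm => by rw [h m hm]; simp
    have h2 : ∑ m ∈ Omega d n, gridChar d n j (-m) = 0 := by
      rw [sum_Omega_neg hn (gridChar_periodic hn j), sum_gridChar_OmegaStar hn hj']
    have h3 : (∑ k ∈ Omega d n, (cf k : ℂ) * gridChar d n j (-k)) * lam d n K j 0 = 0 := by
      rw [← h1]
      push_cast
      simp only [mul_add, Finset.sum_add_distrib, ← Finset.sum_mul, h2, zero_mul, zero_add,
        Finset.mul_sum]
      rw [Finset.sum_comm, Finset.sum_mul]
      refine Finset.sum_congr rfl fun k _ => ?_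
      rw [mul_assoc, ← hlam, Finset.mul_sum]
      exact Finset.sum_congr rfl fun m _ => by ring
    refine (mul_eq_zero.1 h3).resolve_right fun h4 => hrho j hj' ?_
    rw [rho, h4, Complex.zero_re, mul_zero]
  have hzero : ∀ p ∈ Omega d n, cf p = 0 := by
    intro p hp
    have h1 : ∑ j ∈ Omega d n, gridChar d n j p *
        ∑ k ∈ Omega d n, (cf k : ℂ) * gridChar d n j (-k) = 0 :=
      Finset.sum_eq_zero fun j hj => by rw [hdft j hj, mul_zero]
    have h2 : ∑ j ∈ Omega d n, gridChar d n j p *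
        ∑ k ∈ Omega d n, (cf k : ℂ) * gridChar d n j (-k) =
        ∑ k ∈ Omega d n, (cf k : ℂ) * if k = p then (Nn d n : ℂ) else 0 := by
      simp only [Finset.mul_sum]
      rw [Finset.sum_comm]
      refine Finset.sum_congr rfl fun k hk => ?_
      rw [← sum_gridChar_sub hn hp hk, Finset.mul_sum]
      refine Finset.sum_congr rfl fun j _ => ?_
      rw [sub_eq_add_neg, gridChar_add]
      ring
    rw [h1] at h2
    simp only [mul_ite, mul_zero, Finset.sum_ite_eq', hp, if_true] at h2
    exact_mod_cast (mul_eq_zero.1 h2.symm).resolve_right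
      (Complex.ofReal_ne_zero.2 (Nn_pos hn).ne')
  refine ⟨?_, hzero⟩
  have h0 := h 0 (zero_mem_Omega hn)
  rwa [Finset.sum_eq_zero fun k hk => by rw [hzero k hk, zero_mul], add_zero] at h0

lemma IsSkSpline.eq_of_eqOn_knots (hn : ∀ i, 1 ≤ n i)
    (hK : ∀ x, GridPeriodic d n fun k => K (x - knot d n k)) (heven : ∀ x, K (-x) = K x)
    (hrho : ∀ j ∈ OmegaStar d n, rho d n K j 0 ≠ 0) {S T : (Fin d → ℝ) → ℝ}
    (hS : IsSkSpline d n K S) (hT : IsSkSpline d n K T)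
    (h : ∀ k ∈ Omega d n, S (knot d n k) = T (knot d n k)) : S = T := by
  obtain ⟨c, cf, hcf, hS⟩ := hS
  obtain ⟨e, ef, hef, hT⟩ := hT
  have hdiff : ∀ x, (c - e) + ∑ k ∈ Omega d n, (cf k - ef k) * K (x - knot d n k) =
      S x - T x := fun x => by
    simp only [hS, hT, sub_mul, Finset.sum_sub_distrib]
    ring
  obtain ⟨hc, hk⟩ := skSpline_coeff_eq_zero hn hK heven hrho (c := c - e)
    (cf := fun k => cf k - ef k) (by rw [Finset.sum_sub_distrib, hcf, hef, sub_zero])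
    fun m hm => by rw [hdiff, h m hm, sub_self]
  funext x
  rw [← sub_eq_zero, ← hdiff, hc, Finset.sum_eq_zero fun k hk' => by rw [hk k hk', zero_mul],
    add_zero]

end Kernel

lemma Kr_neg {d : ℕ} {a : (Fin d → ℤ) → ℝ} (ha : ∀ l, a (-l) = a l) (x : Fin d → ℝ) :
    Kr d a (-x) = Kr d a x := by
  rw [Kr, Kr, Kc, Kc, ← (Equiv.neg (Fin d → ℤ)).tsum_eq]
  simp [ha, dotI]

lemma Kr_sub_knot_periodic {d : ℕ} {n : Fin d → ℕ} (hn : ∀ i, 1 ≤ n i)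
    (a : (Fin d → ℤ) → ℝ) (x : Fin d → ℝ) :
    GridPeriodic d n fun k => Kr d a (x - knot d n k) := by
  intro k k' h
  have hx : x - knot d n k = x - knot d n k' + knot d n (k' - k) := by
    rw [knot_sub]
    abel
  have hk : ∀ i, (k' - k) i ≡ 0 [ZMOD 2 * (n i : ℤ)] := fun i => by
    simpa using (h i).symm.sub_right (k i)
  simp only [Kr, Kc, hx, exp_dotI_add_knot hn _ _ _ hk]

/-- Theorem 2: existence and uniqueness of the interpolating sk-spline, which is given
by `sk_n(f,x) = Σ_{k∈Ω_n} f(x_k) s̃k_n(x - x_k)`. -/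
theorem statement8 (d : ℕ) (hd : 1 ≤ d) (n : Fin d → ℕ) (hn : ∀ i, 1 ≤ n i)
    (a : (Fin d → ℤ) → ℝ) (ha : ∀ l, a (-l) = a l)
    (hsum : Summable fun l : Fin d → ℤ => |a l|)
    (hrho : ∀ j ∈ OmegaStar d n, rho d n (Kr d a) j 0 ≠ 0)
    (f : (Fin d → ℝ) → ℝ) :
    (IsSkSpline d n (Kr d a) (skInterp d n (Kr d a) f) ∧
      ∀ k ∈ Omega d n, skInterp d n (Kr d a) f (knot d n k) = f (knot d n k)) ∧
    (∀ S : (Fin d → ℝ) → ℝ, IsSkSpline d n (Kr d a) S →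
      (∀ k ∈ Omega d n, S (knot d n k) = f (knot d n k)) →
      S = skInterp d n (Kr d a) f) := by
  have hK := Kr_sub_knot_periodic hn a
  have hinterp : ∀ k ∈ Omega d n, skInterp d n (Kr d a) f (knot d n k) = f (knot d n k) :=
    fun k hk => skInterp_knot hn hK (Kr_neg ha) hrho f hk
  have hspline := isSkSpline_skInterp hn hK f
  exact ⟨⟨hspline, hinterp⟩, fun S hS hSf => hS.eq_of_eqOn_knots hn hK (Kr_neg ha) hrho hspline
    fun k hk => (hSf k hk).trans (hinterp k hk).symm⟩

end
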